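/- arXiv:2601.10901 — 2 statements merged into one kernel-verified Lean document; each statement's English description precedes it below -/
import Mathlib

section
/- Local greedy is 1/2-competitive under a partition constraint: Let U be a finite type and f : Finset U → ℝ be nonnegative, monotone and submodular. Let V^1, …, V^T ⊆ U be pairwise disjoint sets, let k ∈ ℕ, and for each t ∈ {1, …, T} let G^t = {g^t_1, …, g^t_k} ⊆ V^t consist of distinct elements chosen greedily in this order, meaning that for every l ∈ {1, …, k} and every v ∈ V^t, f({g^t_l} | (⋃_{s<t} G^s) ∪ {g^t_1, …, g^t_{l−1}}) ≥ f({v} | (⋃_{s<t} G^s) ∪ {g^t_1, …, g^t_{l−1}}). Then for every choice of sets O^t ⊆ V^t with |O^t| ≤ k for all t ∈ {1, …, T}, f(⋃_{t=1}^T O^t) ≤ 2 · f(⋃_{t=1}^T G^t). -/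
/-- A set function is submodular if
`f (A ∪ {e}) - f A ≥ f (B ∪ {e}) - f B` for all `A ⊆ B` and `e ∉ B`. -/
def IsSubmodular {U : Type*} [DecidableEq U] (f : Finset U → ℝ) : Prop :=
  ∀ A B : Finset U, A ⊆ B → ∀ e ∉ B, f (insert e A) - f A ≥ f (insert e B) - f B

/-- A set function is monotone if `f A ≤ f B` whenever `A ⊆ B`. -/
def IsMonotoneFn {U : Type*} [DecidableEq U] (f : Finset U → ℝ) : Prop :=
  ∀ A B : Finset U, A ⊆ B → f A ≤ f B

/-- The marginal gain `f(A | B) = f (A ∪ B) - f B`. -/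
def marg {U : Type*} [DecidableEq U] (f : Finset U → ℝ) (A B : Finset U) : ℝ :=
  f (A ∪ B) - f B

/-- For a monotone submodular function the marginal gain of an element is antitone. -/
theorem marg_singleton_antitone {U : Type*} [DecidableEq U] {f : Finset U → ℝ}
    (hmono : IsMonotoneFn f) (hsub : IsSubmodular f) {A B : Finset U} (hAB : A ⊆ B) (e : U) :
    marg f {e} B ≤ marg f {e} A := by
  unfold marg
  by_cases he : e ∈ B
  · have h : {e} ∪ B = B := Finset.union_eq_right.2 (Finset.singleton_subset_iff.2 he)
    rw [h, sub_self]
    exact sub_nonneg.2 (hmono _ _ Finset.subset_union_right)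
  · simpa only [Finset.singleton_union] using hsub A B hAB e he

/-- Adding a set gains at most the sum of the marginal gains of its elements. -/
theorem marg_le_sum_marg_singleton {U : Type*} [DecidableEq U] {f : Finset U → ℝ}
    (hmono : IsMonotoneFn f) (hsub : IsSubmodular f) (S B : Finset U) :
    marg f S B ≤ ∑ o ∈ S, marg f {o} B := by
  induction S using Finset.induction_on with
  | empty => simp [marg]
  | insert a S ha ih =>
    rw [Finset.sum_insert ha]
    have h := marg_singleton_antitone hmono hsub (Finset.subset_union_right : B ⊆ S ∪ B) a
    have h' : {a} ∪ (S ∪ B) = insert a S ∪ B := by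
      rw [Finset.singleton_union, Finset.insert_union]
    simp only [marg, h'] at h ih ⊢
    linarith

/-- The successive marginal gains of a sequence of sets telescope. -/
theorem sum_marg_eq_sub {U : Type*} [DecidableEq U] (f : Finset U → ℝ) {n : ℕ}
    (h : Fin n → Finset U) (D : Finset U) :
    ∑ i, marg f (h i) (D ∪ (Finset.univ.filter (fun j => j < i)).biUnion h)
      = f (D ∪ Finset.univ.biUnion h) - f D := by
  let F : ℕ → ℝ := fun i => f (D ∪ (Finset.univ.filter (fun j : Fin n => j.val < i)).biUnion h)
  have hstep : ∀ i : Fin n, marg f (h i) (D ∪ (Finset.univ.filter (fun j => j < i)).biUnion h)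
      = F (i + 1) - F i := by
    intro i
    have hins : Finset.univ.filter (fun j : Fin n => j.val < i + 1)
        = insert i (Finset.univ.filter (fun j => j < i)) := by
      ext j
      simp only [Finset.mem_filter, Finset.mem_univ, true_and, Finset.mem_insert, Fin.ext_iff,
        Fin.lt_def]
      omega
    simp only [F, marg, hins, Finset.biUnion_insert, Finset.union_left_comm, Fin.lt_def]
  rw [Finset.sum_congr rfl fun i _ => hstep i,
    Fin.sum_univ_eq_sum_range (fun i => F (i + 1) - F i) n, Finset.sum_range_sub]
  simp [F]

/-- If every `a i` is at most every `b j` and `b` is nonnegative, a sum of at most as many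
values of `a` as there are values of `b` is at most the sum of `b`. -/
theorem sum_le_sum_of_card_le {α β : Type*} [Fintype β] {s : Finset α} {a : α → ℝ} {b : β → ℝ}
    (hs : s.card ≤ Fintype.card β) (hab : ∀ i ∈ s, ∀ j, a i ≤ b j) (hb : ∀ j, 0 ≤ b j) :
    ∑ i ∈ s, a i ≤ ∑ j, b j := by
  obtain ⟨e⟩ : Nonempty (s ↪ β) :=
    Function.Embedding.nonempty_of_card_le (by simpa using hs)
  calc ∑ i ∈ s, a i = ∑ i : s, a i := (Finset.sum_coe_sort s a).symm
    _ ≤ ∑ i : s, b (e i) := Finset.sum_le_sum fun i _ => hab i i.2 _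
    _ = ∑ j ∈ Finset.univ.map e, b j := (Finset.sum_map _ _ _).symm
    _ ≤ ∑ j, b j := Finset.sum_le_sum_of_subset_of_nonneg (Finset.subset_univ _) fun j _ _ => hb j

/-- Local greedy is 1/2-competitive under a partition constraint.
`V 0, …, V (T-1)` are pairwise disjoint; on each partition `t` the algorithm
greedily picks `k` distinct elements `g t 0, …, g t (k-1) ∈ V t`, each maximizing
the marginal gain with respect to the union of all previously output sets together
with the elements already picked in the current round. Then for any feasible
choice `O t ⊆ V t`, `|O t| ≤ k`, we have `f (⋃ O t) ≤ 2 * f (⋃ G t)`. -/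
theorem local_greedy_half_competitive {U : Type*} [Fintype U] [DecidableEq U]
    (f : Finset U → ℝ) (hnonneg : ∀ A : Finset U, 0 ≤ f A)
    (hmono : IsMonotoneFn f) (hsub : IsSubmodular f)
    (T k : ℕ) (V : Fin T → Finset U)
    (hdisj : ∀ s t : Fin T, s ≠ t → Disjoint (V s) (V t))
    (g : Fin T → Fin k → U)
    (hginj : ∀ t, Function.Injective (g t))
    (hgV : ∀ t l, g t l ∈ V t)
    (hgreedy : ∀ t : Fin T, ∀ l : Fin k, ∀ v ∈ V t,
      marg f {g t l}
          (((Finset.univ.filter (fun s : Fin T => s < t)).biUnion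
              (fun s => Finset.univ.image (g s)))
            ∪ (Finset.univ.filter (fun m : Fin k => m < l)).image (g t))
        ≥ marg f {v}
          (((Finset.univ.filter (fun s : Fin T => s < t)).biUnion
              (fun s => Finset.univ.image (g s)))
            ∪ (Finset.univ.filter (fun m : Fin k => m < l)).image (g t)))
    (O : Fin T → Finset U) (hOV : ∀ t, O t ⊆ V t) (hOk : ∀ t, (O t).card ≤ k) :
    f (Finset.univ.biUnion O)
      ≤ 2 * f (Finset.univ.biUnion (fun t => Finset.univ.image (g t))) := by
  set G : Fin T → Finset U := fun t => Finset.univ.image (g t)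
  let P : Fin T → Finset U := fun t => (Finset.univ.filter (fun s : Fin T => s < t)).biUnion G
  let Q : Fin T → Fin k → Finset U := fun t l =>
    P t ∪ (Finset.univ.filter (fun m : Fin k => m < l)).image (g t)
  have hQ : ∀ t l, Q t l ⊆ Finset.univ.biUnion G := fun t l =>
    Finset.union_subset (Finset.biUnion_subset_biUnion_of_subset_left _ (Finset.subset_univ _))
      ((Finset.image_subset_image (Finset.subset_univ _)).trans
        (Finset.subset_biUnion_of_mem G (Finset.mem_univ t)))
  have hround : ∀ t, ∑ l, marg f {g t l} (Q t l) = marg f (G t) (P t) := by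
    intro t
    have himage : ∀ s : Finset (Fin k), s.biUnion (fun m => {g t m}) = s.image (g t) :=
      fun s => Finset.biUnion_singleton
    have h := sum_marg_eq_sub f (fun m => {g t m}) (P t)
    simp only [himage] at h
    rw [marg, Finset.union_comm (G t)]
    exact h
  have htotal : ∑ t, marg f (G t) (P t) = f (Finset.univ.biUnion G) - f ∅ := by
    simpa only [Finset.empty_union] using sum_marg_eq_sub f G ∅
  have hopt : ∀ t, ∑ o ∈ O t, marg f {o} (Finset.univ.biUnion G) ≤ marg f (G t) (P t) := by
    intro t
    rw [← hround t]
    refine sum_le_sum_of_card_le (by simpa using hOk t) (fun o ho l => ?_)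
      fun l => sub_nonneg.2 (hmono _ _ Finset.subset_union_right)
    exact (marg_singleton_antitone hmono hsub (hQ t l) o).trans (hgreedy t l o (hOV t ho))
  have hgain := marg_le_sum_marg_singleton hmono hsub (Finset.univ.biUnion O)
    (Finset.univ.biUnion G)
  rw [Finset.sum_biUnion fun s _ t _ hst => (hdisj s t hst).mono (hOV s) (hOV t)] at hgain
  have hsum := hgain.trans (Finset.sum_le_sum fun t _ => hopt t)
  rw [htotal, marg] at hsum
  have hO := hmono (Finset.univ.biUnion O) (Finset.univ.biUnion O ∪ Finset.univ.biUnion G)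
    Finset.subset_union_left
  linarith [hnonneg ∅]
end

section
/- Let U be a finite type and f : Finset U → ℝ be nonnegative, monotone and submodular. Let T ≤ T' be positive integers, let A^1, …, A^{T'} ⊆ U be sets, and let π : {1, …, T} → {1, …, T'} be injective. Suppose that the last selection is greedy among the remaining sets: for every s ∈ {1, …, T'} with s ∉ {π(1), …, π(T−1)}, f(A^{π(T)} | ⋃_{t=1}^{T−1} A^{π(t)}) ≥ f(A^s | ⋃_{t=1}^{T−1} A^{π(t)}). Then f(⋃_{t=1}^{T} A^{π(t)}) ≥ (1/(T'−T+1)) · f(⋃_{t=1}^{T'} A^t). -/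
/-- Marginal gains of a monotone submodular function decrease in the base set. -/
theorem marg_anti {U : Type*} [DecidableEq U] {f : Finset U → ℝ}
    (hmono : IsMonotoneFn f) (hsub : IsSubmodular f) {S S' : Finset U} (h : S ⊆ S')
    (X : Finset U) : marg f X S' ≤ marg f X S := by
  unfold marg
  induction X using Finset.induction_on with
  | empty => simp
  | insert e X _ ih =>
    rw [Finset.insert_union, Finset.insert_union]
    by_cases he : e ∈ X ∪ S'
    · rw [Finset.insert_eq_of_mem he]
      have := hmono (X ∪ S) (insert e (X ∪ S)) (Finset.subset_insert _ _)
      linarith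
    · have := hsub (X ∪ S) (X ∪ S') (Finset.union_subset_union_right h) e he
      linarith

/-- The marginal gain of a union is at most the sum of the marginal gains. -/
theorem marg_biUnion_le_sum {U ι : Type*} [DecidableEq U] {f : Finset U → ℝ}
    (hmono : IsMonotoneFn f) (hsub : IsSubmodular f) (S : Finset U)
    (R : Finset ι) (A : ι → Finset U) :
    marg f (R.biUnion A) S ≤ ∑ s ∈ R, marg f (A s) S := by
  classical
  induction R using Finset.induction_on with
  | empty => simp [marg]
  | insert s R hs ih =>
    rw [Finset.sum_insert hs, Finset.biUnion_insert]
    have h : marg f (A s) (R.biUnion A ∪ S) ≤ marg f (A s) S :=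
      marg_anti hmono hsub Finset.subset_union_right _
    unfold marg at *
    rw [Finset.union_assoc]
    linarith

/-- Let `T ≤ T'` be positive, `A^1, …, A^{T'}` sets, and
`π : {1,…,T} → {1,…,T'}` injective. If the last selection `A^{π(T)}` has the
largest marginal gain, over all sets `A^s` with `s` not among the previously
selected indices, with respect to `⋃_{t<T} A^{π(t)}`, then
`f (⋃_{t=1}^{T} A^{π(t)}) ≥ (1/(T'-T+1)) * f (⋃_{t=1}^{T'} A^t)`. -/
theorem greedy_last_selection {U : Type*} [Fintype U] [DecidableEq U]
    (f : Finset U → ℝ) (hnonneg : ∀ A : Finset U, 0 ≤ f A)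
    (hmono : IsMonotoneFn f) (hsub : IsSubmodular f)
    (T T' : ℕ) (hT : 0 < T) (hTT' : T ≤ T')
    (A : Fin T' → Finset U) (π : Fin T → Fin T') (hπ : Function.Injective π)
    (hgreedy : ∀ s : Fin T', (∀ t : Fin T, (t : ℕ) < T - 1 → π t ≠ s) →
      marg f (A (π ⟨T - 1, by omega⟩))
          ((Finset.univ.filter (fun t : Fin T => (t : ℕ) < T - 1)).biUnion
            (fun t => A (π t)))
        ≥ marg f (A s)
          ((Finset.univ.filter (fun t : Fin T => (t : ℕ) < T - 1)).biUnion
            (fun t => A (π t)))) :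
    f (Finset.univ.biUnion (fun t : Fin T => A (π t)))
      ≥ (1 / ((T' : ℝ) - T + 1)) * f (Finset.univ.biUnion A) := by
  set P := Finset.univ.filter (fun t : Fin T => (t : ℕ) < T - 1) with hP
  set S := P.biUnion (fun t => A (π t)) with hS
  set g := marg f (A (π ⟨T - 1, by omega⟩)) S with hg
  have hPcard : P.card = T - 1 := by
    rw [hP, Fin.card_filter_val_lt]
    omega
  have hRcard : ((P.image π)ᶜ.card : ℝ) = (T' : ℝ) - T + 1 := by
    rw [Finset.card_compl, Finset.card_image_of_injective _ hπ, hPcard, Fintype.card_fin,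
      Nat.cast_sub (by omega), Nat.cast_sub (by omega)]
    push_cast
    ring
  have hgain : marg f ((P.image π)ᶜ.biUnion A) S ≤ ((T' : ℝ) - T + 1) * g := by
    rw [← hRcard, ← nsmul_eq_mul]
    refine (marg_biUnion_le_sum hmono hsub S _ A).trans (Finset.sum_le_card_nsmul _ _ _ ?_)
    intro s hs
    refine hgreedy s fun t ht hts => ?_
    exact Finset.mem_compl.mp hs (Finset.mem_image.mpr ⟨t, by simp [hP, ht], hts⟩)
  have hall : (P.image π)ᶜ.biUnion A ∪ S = Finset.univ.biUnion A := by
    rw [hS, ← Finset.image_biUnion (s := P) (f := π) (t := A), ← Finset.union_biUnion, Finset.union_comm,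
      Finset.union_compl]
  have hlast : A (π ⟨T - 1, by omega⟩) ∪ S ⊆ Finset.univ.biUnion (fun t : Fin T => A (π t)) :=
    Finset.union_subset
      (Finset.subset_biUnion_of_mem (fun t : Fin T => A (π t)) (Finset.mem_univ _))
      (Finset.biUnion_subset_biUnion_of_subset_left _ (Finset.subset_univ _))
  have hfinal := hmono _ _ hlast
  have hK : (1 : ℝ) ≤ (T' : ℝ) - T + 1 := by
    have : (T : ℝ) ≤ T' := by exact_mod_cast hTT'
    linarith
  have hS0 := hnonneg S
  unfold marg at hgain hg
  rw [hall] at hgain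
  rw [ge_iff_le, one_div, inv_mul_le_iff₀ (by linarith)]
  nlinarith
end
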